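/- Let T > 0, let λ : ℕ → [0,∞) be a sequence, let ω be a continuity modulus, and let c_n : [0,T] → ℝ (n ∈ ℕ) satisfy μ₁ ≤ c_n(t) ≤ μ₂ (with 0 < μ₁ ≤ μ₂) and |c_n(a) − c_n(b)| ≤ ω(|a−b|) for all a,b ∈ [0,T], converging pointwise on [0,T] to c_∞ : [0,T] → ℝ. Let σ ∈ [0,1/2] and δ > 0 be real numbers such that 4δ²μ₁ > Λ_∞² + 2δΛ_∞, where Λ_∞ := limsup_{ε→0⁺} ω(ε)/ε^{1−2σ}. Let (u⁰,u¹) ∈ D(A^{1/2}) × H, let u_n be a solution on [0,T] of the linear equation u'' + 2δ A^σ u' + c_n(t) A u = 0 with initial data (u⁰,u¹), and let u_∞ be a solution on [0,T] of the same equation with coefficient c_∞ and the same initial data. Then sup_{t∈[0,T]} ( |u_∞'(t) − u_n'(t)|² + |A^{1/2}(u_∞(t) − u_n(t))|² ) → 0 as n → ∞. -/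

import Mathlib

open Set Filter MeasureTheory Topology

noncomputable section

/-- A continuity modulus: continuous on `[0,∞)`, vanishing at `0`, positive for positive
arguments, nondecreasing, and such that `x ↦ x / ω x` is nondecreasing on `(0,∞)`. -/
def IsModulus (ω : ℝ → ℝ) : Prop :=
  ContinuousOn ω (Ici 0) ∧ ω 0 = 0 ∧ (∀ x : ℝ, 0 < x → 0 < ω x) ∧
  (∀ x y : ℝ, 0 ≤ x → x ≤ y → ω x ≤ ω y) ∧
  (∀ x y : ℝ, 0 < x → x ≤ y → x / ω x ≤ y / ω y)

/-- The curve `t ↦ (v t k)_k` takes values in `ℓ²` and is continuous on `I`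
with respect to the `ℓ²` norm. -/
def L2Cont (I : Set ℝ) (v : ℝ → ℕ → ℝ) : Prop :=
  (∀ t ∈ I, Summable fun k => (v t k) ^ 2) ∧
  ∀ t ∈ I, ∀ ε : ℝ, 0 < ε → ∃ η > (0:ℝ), ∀ s ∈ I, |s - t| < η →
    (∑' k, (v s k - v t k) ^ 2) < ε

/-- A solution on `[0,T]` of the linear equation `u'' + 2δ A^σ u' + c(t) A u = 0` with
initial data `(u0, u1)`, in the diagonal setting.  Each component `u k` is `C¹` with
derivative `v k`, and `v k` is absolutely continuous with the equation holding a.e.,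
which is encoded through the integral formulation; moreover the curves `t ↦ u(t)`,
`t ↦ A^{1/2}u(t)`, `t ↦ u'(t)` are continuous with values in `ℓ²`. -/
def IsLinearSol (lam : ℕ → ℝ) (c : ℝ → ℝ) (σ δ : ℝ) (T : ℝ)
    (u0 u1 : ℕ → ℝ) (u v : ℕ → ℝ → ℝ) : Prop :=
  (∀ k, u k 0 = u0 k) ∧
  (∀ k, v k 0 = u1 k) ∧
  (∀ k, ∀ t ∈ Icc (0:ℝ) T, HasDerivWithinAt (u k) (v k t) (Icc 0 T) t) ∧
  (∀ k, ∀ t ∈ Icc (0:ℝ) T, v k t = u1 k - ∫ s in (0:ℝ)..t,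
      (2 * δ * lam k ^ (2 * σ) * v k s + c s * lam k ^ 2 * u k s)) ∧
  L2Cont (Icc 0 T) (fun t k => u k t) ∧
  L2Cont (Icc 0 T) (fun t k => lam k * u k t) ∧
  L2Cont (Icc 0 T) (fun t k => v k t)

theorem add_le_mul_exp_of_hasDerivWithinAt_le {T K e : ℝ} {F F' : ℝ → ℝ}
    (hF : ∀ t ∈ Icc (0:ℝ) T, HasDerivWithinAt F (F' t) (Icc 0 T) t)
    (h : ∀ t ∈ Icc (0:ℝ) T, F' t ≤ K * (F t + e)) {t : ℝ} (ht : t ∈ Icc (0:ℝ) T) :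
    F t + e ≤ (F 0 + e) * Real.exp (K * t) := by
  have hG : ∀ s ∈ Icc (0:ℝ) T, HasDerivWithinAt (fun s => (F s + e) * Real.exp (-(K * s)))
      (F' s * Real.exp (-(K * s)) + (F s + e) * (Real.exp (-(K * s)) * (-(K * 1))))
      (Icc 0 T) s := fun s hs =>
    ((hF s hs).add_const e).mul ((((hasDerivAt_id s).const_mul K).neg).exp).hasDerivWithinAt
  have hanti : AntitoneOn (fun s => (F s + e) * Real.exp (-(K * s))) (Icc 0 T) := by
    refine antitoneOn_of_hasDerivWithinAt_nonpos (convex_Icc 0 T)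
      (fun s hs => (hG s hs).continuousWithinAt)
      (fun s hs => (hG s (interior_subset hs)).mono interior_subset) (fun s hs => ?_)
    have := h s (interior_subset hs)
    have he := Real.exp_pos (-(K * s))
    nlinarith
  have h0 := hanti ⟨le_refl 0, ht.1.trans ht.2⟩ ht ht.1
  simp only [mul_zero, neg_zero, Real.exp_zero, mul_one] at h0
  rw [Real.exp_neg, ← div_eq_mul_inv, div_le_iff₀ (Real.exp_pos _)] at h0
  exact h0

/-- Exponential energy bound for the forced scalar equation `u'' + 2 b u' + c l² u = f`. -/
theorem energy_le_exp {T b l μ η : ℝ} {c f u v : ℝ → ℝ} (hb : 0 ≤ b) (hl : 0 ≤ l) (hμ : 0 ≤ μ)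
    (hu : ∀ t ∈ Icc (0:ℝ) T, HasDerivWithinAt u (v t) (Icc 0 T) t)
    (hv : ∀ t ∈ Icc (0:ℝ) T,
      HasDerivWithinAt v (-(2 * b * v t + c t * l ^ 2 * u t) + f t) (Icc 0 T) t)
    (hc : ∀ t ∈ Icc (0:ℝ) T, |c t| ≤ μ) (hf : ∀ t ∈ Icc (0:ℝ) T, |f t| ≤ η)
    {t : ℝ} (ht : t ∈ Icc (0:ℝ) T) :
    v t ^ 2 + l ^ 2 * u t ^ 2 ≤
      (v 0 ^ 2 + l ^ 2 * u 0 ^ 2 + η ^ 2) * Real.exp ((l * (1 + μ) + 1) * T) := by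
  have key := add_le_mul_exp_of_hasDerivWithinAt_le (T := T) (K := l * (1 + μ) + 1) (e := η ^ 2)
    (F := fun t => v t ^ 2 + l ^ 2 * u t ^ 2)
    (fun t ht => ((hv t ht).pow 2).add (((hu t ht).pow 2).const_mul (l ^ 2))) ?_ ht
  · have hK : 0 ≤ l * (1 + μ) + 1 := by positivity
    have hexp : Real.exp ((l * (1 + μ) + 1) * t) ≤ Real.exp ((l * (1 + μ) + 1) * T) :=
      Real.exp_le_exp.2 (mul_le_mul_of_nonneg_left ht.2 hK)
    have h2 : 0 ≤ v 0 ^ 2 + l ^ 2 * u 0 ^ 2 + η ^ 2 := by positivity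
    have := mul_le_mul_of_nonneg_left hexp h2
    have := sq_nonneg η
    linarith
  · intro s hs
    have hη : f s ^ 2 ≤ η ^ 2 := sq_le_sq.2 ((hf s hs).trans (le_abs_self η))
    have h1 : (1 - c s) * (2 * (l * u s) * v s) ≤ (1 + μ) * (v s ^ 2 + (l * u s) ^ 2) := by
      have ha : |1 - c s| ≤ 1 + μ := (abs_sub _ _).trans (by simpa using hc s hs)
      have hb : |2 * (l * u s) * v s| ≤ v s ^ 2 + (l * u s) ^ 2 :=
        abs_le.2 ⟨by nlinarith [sq_nonneg (v s + l * u s)],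
          by nlinarith [sq_nonneg (v s - l * u s)]⟩
      calc _ ≤ |(1 - c s) * (2 * (l * u s) * v s)| := le_abs_self _
        _ = |1 - c s| * |2 * (l * u s) * v s| := abs_mul _ _
        _ ≤ _ := by gcongr
    have h2 := mul_le_mul_of_nonneg_left h1 hl
    have h3 : 0 ≤ b * v s ^ 2 := by positivity
    have h4 : 0 ≤ l * (1 + μ) * η ^ 2 := by positivity
    have h5 : 0 ≤ l ^ 2 * u s ^ 2 := by positivity
    norm_num
    nlinarith [sq_nonneg (v s - f s)]

theorem continuous_of_abs_sub_le_modulus {ω c : ℝ → ℝ} (hω : IsModulus ω)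
    (hc : ∀ a b, |c a - c b| ≤ ω |a - b|) : Continuous c := by
  rw [continuous_iff_continuousAt]
  intro a
  rw [ContinuousAt, tendsto_iff_norm_sub_tendsto_zero]
  have h0 : Tendsto (fun b => ω |b - a|) (𝓝 a) (𝓝 0) := by
    have h1 : Tendsto (fun b => |b - a|) (𝓝 a) (𝓝[Ici 0] 0) := by
      refine tendsto_nhdsWithin_iff.2 ⟨?_, Eventually.of_forall fun b => mem_Ici.2 (abs_nonneg _)⟩
      have : Continuous fun b => |b - a| := by fun_prop
      simpa using this.tendsto a
    have h2 := (hω.1 0 self_mem_Ici).tendsto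
    rw [hω.2.1] at h2
    exact h2.comp h1
  exact squeeze_zero (fun b => norm_nonneg _) (fun b => hc b a) h0

theorem abs_comp_projIcc_sub_le_modulus {T : ℝ} (hT : 0 ≤ T) {ω c : ℝ → ℝ} (hω : IsModulus ω)
    (hc : ∀ a ∈ Icc (0:ℝ) T, ∀ b ∈ Icc (0:ℝ) T, |c a - c b| ≤ ω |a - b|) (a b : ℝ) :
    |c (projIcc 0 T hT a) - c (projIcc 0 T hT b)| ≤ ω |a - b| :=
  (hc _ (projIcc 0 T hT a).2 _ (projIcc 0 T hT b).2).trans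
    (hω.2.2.2.1 _ _ (abs_nonneg _) (abs_projIcc_sub_projIcc hT))

theorem continuousOn_of_modulus {T : ℝ} {ω c : ℝ → ℝ} (hω : IsModulus ω)
    (hc : ∀ a ∈ Icc (0:ℝ) T, ∀ b ∈ Icc (0:ℝ) T, |c a - c b| ≤ ω |a - b|) :
    ContinuousOn c (Icc 0 T) := by
  rcases le_or_gt 0 T with hT | hT
  · refine (continuous_of_abs_sub_le_modulus hω
      (abs_comp_projIcc_sub_le_modulus hT hω hc)).continuousOn.congr fun s hs => ?_
    simp only [projIcc_of_mem hT hs]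
  · simp [Icc_eq_empty_of_lt hT]

/-- High-frequency estimate: the energy
`(u' + b u)² + b² u² + cε l² u²`, with `cε` the average of `c` over a window of length `1/l`,
is nonincreasing. -/
theorem energy_le_of_subcritical {T δ L l m Λ μ₁ μ₂ : ℝ} {c u v : ℝ → ℝ} (hδ : 0 < δ)
    (hl : 0 < l) (hL : 0 ≤ L) (hLl : L ≤ l) (hμ₁ : 0 < μ₁)
    (hcc : Continuous c) (hc : ∀ t, μ₁ ≤ c t ∧ c t ≤ μ₂)
    (hm : ∀ s t, |s - t| ≤ 1 / l → |c s - c t| ≤ m) (hmΛ : m * l ≤ Λ * L)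
    (hΛ : Λ ^ 2 + 2 * δ * Λ ≤ 4 * δ ^ 2 * μ₁)
    (hu : ∀ t ∈ Icc (0:ℝ) T, HasDerivWithinAt u (v t) (Icc 0 T) t)
    (hv : ∀ t ∈ Icc (0:ℝ) T,
      HasDerivWithinAt v (-(2 * (δ * L) * v t + c t * l ^ 2 * u t)) (Icc 0 T) t)
    {t : ℝ} (ht : t ∈ Icc (0:ℝ) T) :
    v t ^ 2 + l ^ 2 * u t ^ 2 ≤
      (2 + 1 / μ₁) * (2 + 3 * δ ^ 2 + μ₂) * (v 0 ^ 2 + l ^ 2 * u 0 ^ 2) := by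
  have hl' : 0 ≤ 1 / l := by positivity
  have hint : ∀ a b, IntervalIntegrable c volume a b := hcc.intervalIntegrable
  set Φ : ℝ → ℝ := fun x => ∫ s in (0:ℝ)..x, c s with hΦ
  have hΦd : ∀ x, HasDerivAt Φ (c x) x := fun x => hcc.integral_hasStrictDerivAt 0 x |>.hasDerivAt
  set ce : ℝ → ℝ := fun x => l * (Φ (x + 1 / l) - Φ x) with hce
  have hced : ∀ x, HasDerivAt ce (l * (c (x + 1 / l) - c x)) x := fun x =>
    (((hΦd (x + 1 / l)).comp_add_const x (1 / l)).sub (hΦd x)).const_mul l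
  have hceint : ∀ x, ce x = l * ∫ s in x..(x + 1 / l), c s := fun x => by
    simp only [hce, hΦ]
    rw [intervalIntegral.integral_interval_sub_left (hint _ _) (hint _ _)]
  have hce1 : ∀ x, μ₁ ≤ ce x := fun x => by
    have := intervalIntegral.integral_mono_on (a := x) (b := x + 1 / l) (by linarith)
      intervalIntegrable_const (hint _ _) (fun s _ => (hc s).1)
    rw [intervalIntegral.integral_const, add_sub_cancel_left, smul_eq_mul] at this
    have h := mul_le_mul_of_nonneg_left this hl.le
    rw [hceint]
    calc μ₁ = l * (1 / l * μ₁) := by field_simp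
      _ ≤ _ := h
  have hce2 : ∀ x, ce x ≤ μ₂ := fun x => by
    have := intervalIntegral.integral_mono_on (a := x) (b := x + 1 / l) (by linarith)
      (hint _ _) intervalIntegrable_const (fun s _ => (hc s).2)
    rw [intervalIntegral.integral_const, add_sub_cancel_left, smul_eq_mul] at this
    have h := mul_le_mul_of_nonneg_left this hl.le
    rw [hceint]
    calc _ ≤ l * (1 / l * μ₂) := h
      _ = μ₂ := by field_simp
  have hcem : ∀ x, |c x - ce x| ≤ m := fun x => by
    have h1 : ce x - c x = l * ∫ s in x..(x + 1 / l), (c s - c x) := by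
      rw [intervalIntegral.integral_sub (hint _ _) intervalIntegrable_const, hceint,
        intervalIntegral.integral_const, add_sub_cancel_left, smul_eq_mul]
      field_simp
    have h2 : ‖∫ s in x..(x + 1 / l), (c s - c x)‖ ≤ m * |x + 1 / l - x| := by
      refine intervalIntegral.norm_integral_le_of_norm_le_const fun s hs => hm s x ?_
      rw [uIoc_of_le (by linarith)] at hs
      exact abs_le.2 ⟨by linarith [hs.1], by linarith [hs.2]⟩
    rw [add_sub_cancel_left, abs_of_nonneg hl', Real.norm_eq_abs] at h2
    rw [abs_sub_comm, h1, abs_mul, abs_of_pos hl]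
    calc _ ≤ l * (m * (1 / l)) := by gcongr
      _ = m := by field_simp
  have key := add_le_mul_exp_of_hasDerivWithinAt_le (T := T) (K := 0) (e := 0)
    (F := fun t => (v t + δ * L * u t) ^ 2 + (δ * L) ^ 2 * u t ^ 2 + l ^ 2 * (ce t * u t ^ 2))
    (fun t ht => ((((hv t ht).add ((hu t ht).const_mul (δ * L))).pow 2).add
      (((hu t ht).pow 2).const_mul ((δ * L) ^ 2))).add
      (((hced t).hasDerivWithinAt.mul ((hu t ht).pow 2)).const_mul (l ^ 2))) ?_ ht
  · simp only [add_zero, zero_mul, Real.exp_zero, mul_one] at key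
    have hlow : (v t ^ 2) / 2 + μ₁ * (l ^ 2 * u t ^ 2) ≤
        (v t + δ * L * u t) ^ 2 + (δ * L) ^ 2 * u t ^ 2 + l ^ 2 * (ce t * u t ^ 2) := by
      have := mul_le_mul_of_nonneg_right (hce1 t) (show 0 ≤ l ^ 2 * u t ^ 2 by positivity)
      nlinarith [sq_nonneg (v t + 2 * (δ * L * u t))]
    have hup : (v 0 + δ * L * u 0) ^ 2 + (δ * L) ^ 2 * u 0 ^ 2 + l ^ 2 * (ce 0 * u 0 ^ 2) ≤
        (2 + 3 * δ ^ 2 + μ₂) * (v 0 ^ 2 + l ^ 2 * u 0 ^ 2) := by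
      have h1 := mul_le_mul_of_nonneg_right (hce2 0) (show 0 ≤ l ^ 2 * u 0 ^ 2 by positivity)
      have h2 : (δ * L) ^ 2 * u 0 ^ 2 ≤ δ ^ 2 * (l ^ 2 * u 0 ^ 2) := by
        rw [mul_pow, mul_assoc]; gcongr
      have h3 : 0 ≤ (3 * δ ^ 2 + μ₂) * v 0 ^ 2 := by
        have : 0 < μ₂ := hμ₁.trans_le ((hc 0).1.trans (hc 0).2)
        positivity
      have h4 : 0 ≤ l ^ 2 * u 0 ^ 2 := by positivity
      nlinarith [sq_nonneg (v 0 - δ * L * u 0)]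
    set X := v t ^ 2
    set Y := l ^ 2 * u t ^ 2
    set A := (2 + 3 * δ ^ 2 + μ₂) * (v 0 ^ 2 + l ^ 2 * u 0 ^ 2)
    have hX : 0 ≤ X := sq_nonneg _
    have hY : 0 ≤ Y := by positivity
    have hA : X / 2 + μ₁ * Y ≤ A := hlow.trans (key.trans hup)
    have hXA : X ≤ 2 * A := by nlinarith
    have hYA : Y ≤ 1 / μ₁ * A := by
      rw [one_div, ← div_eq_inv_mul, le_div_iff₀ hμ₁]; nlinarith
    rw [mul_assoc]
    linarith
  · intro s hs
    have hml : ∀ x, |x| ≤ m → |x * l| ≤ Λ * L := fun x hx => by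
      rw [abs_mul, abs_of_pos hl]
      exact (mul_le_mul_of_nonneg_right hx hl.le).trans hmΛ
    have h1 := hml _ (hcem s)
    have h2 := hml _ (hm (s + 1 / l) s (by rw [add_sub_cancel_left, abs_of_nonneg hl']))
    have h3 : -((c s - ce s) * l * ((l * u s) * v s)) ≤ Λ * L * (|l * u s| * |v s|) := by
      rw [← abs_mul]
      refine (neg_le_abs _).trans ?_
      rw [abs_mul]
      gcongr
    have h4 : (c (s + 1 / l) - c s) * l * (l * u s) ^ 2 ≤ Λ * L * (l * u s) ^ 2 :=
      mul_le_mul_of_nonneg_right ((le_abs_self _).trans h2) (sq_nonneg _)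
    have h5 : 0 ≤ 2 * δ * v s ^ 2 + (2 * δ * μ₁ - Λ) * (l * u s) ^ 2
        - 2 * Λ * (|l * u s| * |v s|) := by
      have hq : 0 ≤ 2 * δ * (2 * δ * v s ^ 2 + (2 * δ * μ₁ - Λ) * (l * u s) ^ 2
          - 2 * Λ * (|l * u s| * |v s|)) := by
        rw [← sq_abs (v s), ← sq_abs (l * u s)]
        nlinarith [sq_nonneg (2 * δ * |v s| - Λ * |l * u s|),
          mul_nonneg (sub_nonneg.2 hΛ) (sq_nonneg |l * u s|)]
      exact nonneg_of_mul_nonneg_right hq (by positivity)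
    have h6 := mul_nonneg hL h5
    have h7 : 2 * δ * L * (μ₁ * (l * u s) ^ 2) ≤ 2 * δ * L * (c s * (l * u s) ^ 2) := by
      have := (hc s).1
      gcongr
    norm_num [-one_div]
    linarith

theorem L2Cont.continuousOn_apply {I : Set ℝ} {v : ℝ → ℕ → ℝ} (h : L2Cont I v) (k : ℕ) :
    ContinuousOn (fun t => v t k) I := by
  rw [Metric.continuousOn_iff]
  intro t ht ε hε
  obtain ⟨η, hη, H⟩ := h.2 t ht (ε ^ 2) (by positivity)
  refine ⟨η, hη, fun s hs hst => ?_⟩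
  have hsum : Summable fun j => (v s j - v t j) ^ 2 := by
    refine Summable.of_nonneg_of_le (fun j => sq_nonneg _) (fun j => ?_)
      (((h.1 s hs).add (h.1 t ht)).mul_left 2)
    nlinarith [sq_nonneg (v s j + v t j)]
  have h1 := (hsum.le_tsum k fun j _ => sq_nonneg _).trans_lt (H s hs hst)
  exact abs_lt_of_sq_lt_sq h1 hε.le

theorem IsLinearSol.hasDerivWithinAt_velocity {lam : ℕ → ℝ} {c : ℝ → ℝ} {σ δ T : ℝ}
    {u0 u1 : ℕ → ℝ} {u v : ℕ → ℝ → ℝ} (h : IsLinearSol lam c σ δ T u0 u1 u v)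
    (hc : ContinuousOn c (Icc 0 T)) (k : ℕ) {t : ℝ} (ht : t ∈ Icc (0:ℝ) T) :
    HasDerivWithinAt (v k)
      (-(2 * (δ * lam k ^ (2 * σ)) * v k t + c t * lam k ^ 2 * u k t)) (Icc 0 T) t := by
  obtain ⟨-, -, hu, hv, -, -, hvc⟩ := h
  have hvk : ContinuousOn (v k) (Icc 0 T) := hvc.continuousOn_apply k
  have huk : ContinuousOn (u k) (Icc 0 T) := fun s hs => (hu k s hs).continuousWithinAt
  have hT : (0:ℝ) ≤ T := ht.1.trans ht.2
  set g : ℝ → ℝ := fun s => 2 * δ * lam k ^ (2 * σ) * v k s + c s * lam k ^ 2 * u k s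
  have hg : ContinuousOn g (Icc 0 T) := by fun_prop
  have hge : Continuous (IccExtend hT ((Icc 0 T).domRestrict g)) :=
    (continuousOn_iff_continuous_domRestrict.1 hg).Icc_extend'
  have hgeq : ∀ s ∈ Icc (0:ℝ) T, IccExtend hT ((Icc 0 T).domRestrict g) s = g s := fun s hs => by
    rw [IccExtend_of_mem hT _ hs]; rfl
  have hd := ((hge.integral_hasStrictDerivAt 0 t).hasDerivAt.const_sub (u1 k)).hasDerivWithinAt
    (s := Icc 0 T)
  rw [hgeq t ht] at hd
  have heq : ∀ s ∈ Icc (0:ℝ) T,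
      v k s = u1 k - ∫ r in (0:ℝ)..s, IccExtend hT ((Icc 0 T).domRestrict g) r := fun s hs => by
    rw [hv k s hs]
    congr 1
    refine intervalIntegral.integral_congr fun r hr => ?_
    rw [uIcc_of_le hs.1] at hr
    exact (hgeq r ⟨hr.1, hr.2.trans hs.2⟩).symm
  refine (hd.congr heq (heq t ht)).congr_deriv ?_
  simp only [g]
  ring

/-- In the subcritical regime the energy of each component is controlled by its initial value,
uniformly in the frequency and in the coefficient. -/
theorem exists_uniform_energy_bound
    {T : ℝ} (hT : 0 < T) {lam : ℕ → ℝ} (hlam : ∀ k, 0 ≤ lam k)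
    {μ₁ μ₂ : ℝ} (hμ₁ : 0 < μ₁) (hμ : μ₁ ≤ μ₂) {ω : ℝ → ℝ} (hω : IsModulus ω)
    {σ δ : ℝ} (hσ : σ ≤ 1 / 2) (hδ : 0 < δ)
    (hΛ : ∃ Λ : ℝ, 0 ≤ Λ ∧ (∀ᶠ x in 𝓝[>] (0:ℝ), ω x / x ^ (1 - 2 * σ) ≤ Λ) ∧
      Λ ^ 2 + 2 * δ * Λ < 4 * δ ^ 2 * μ₁) (u0 u1 : ℕ → ℝ) :
    ∃ C : ℝ, ∀ c : ℝ → ℝ, (∀ t ∈ Icc (0:ℝ) T, μ₁ ≤ c t ∧ c t ≤ μ₂) →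
      (∀ a ∈ Icc (0:ℝ) T, ∀ b ∈ Icc (0:ℝ) T, |c a - c b| ≤ ω |a - b|) →
      ∀ u v : ℕ → ℝ → ℝ, IsLinearSol lam c σ δ T u0 u1 u v → ∀ k, ∀ t ∈ Icc (0:ℝ) T,
        v k t ^ 2 + lam k ^ 2 * u k t ^ 2 ≤ C * (u1 k ^ 2 + lam k ^ 2 * u0 k ^ 2) := by
  obtain ⟨Λ, hΛ0, hev, hlt⟩ := hΛ
  obtain ⟨x₀, hx₀, hx⟩ := mem_nhdsGT_iff_exists_Ioo_subset.1 hev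
  simp only [mem_Ioi] at hx₀
  set R : ℝ := max 1 (1 / x₀)
  set C₁ := Real.exp ((R * (1 + μ₂) + 1) * T)
  set C₂ := (2 + 1 / μ₁) * (2 + 3 * δ ^ 2 + μ₂)
  refine ⟨max C₁ C₂, fun c hc hcω u v hsol k t ht => ?_⟩
  have hμ₂ : 0 < μ₂ := hμ₁.trans_le hμ
  set p : ℝ → ℝ := fun s => projIcc 0 T hT.le s with hp
  have hpmem : ∀ s, p s ∈ Icc (0:ℝ) T := fun s => (projIcc 0 T hT.le s).2
  have hpeq : ∀ s ∈ Icc (0:ℝ) T, p s = s := fun s hs => by simp [hp, projIcc_of_mem hT.le hs]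
  have hpω : ∀ a b, |c (p a) - c (p b)| ≤ ω |a - b| :=
    abs_comp_projIcc_sub_le_modulus hT.le hω hcω
  have hpc : Continuous fun s => c (p s) := continuous_of_abs_sub_le_modulus hω hpω
  have hcc : ContinuousOn c (Icc 0 T) := continuousOn_of_modulus hω hcω
  have hu := hsol.2.2.1 k
  have hv : ∀ s ∈ Icc (0:ℝ) T, _ := fun s hs => hsol.hasDerivWithinAt_velocity hcc k hs
  rw [← hsol.1 k, ← hsol.2.1 k]
  have hE : 0 ≤ v k 0 ^ 2 + lam k ^ 2 * u k 0 ^ 2 := by positivity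
  have hL : 0 ≤ lam k ^ (2 * σ) := Real.rpow_nonneg (hlam k) _
  rcases le_or_gt (lam k) R with hk | hk
  · have h1 := energy_le_exp (T := T) (b := δ * lam k ^ (2 * σ)) (l := lam k) (μ := μ₂) (η := 0)
      (f := 0) (by positivity) (hlam k) hμ₂.le hu (fun s hs => by simpa using hv s hs)
      (fun s hs => abs_le.2 ⟨by linarith [(hc s hs).1], (hc s hs).2⟩)
      (fun s _ => by simp) ht
    have h2 : Real.exp ((lam k * (1 + μ₂) + 1) * T) ≤ max C₁ C₂ :=
      le_trans (Real.exp_le_exp.2 (by gcongr)) (le_max_left _ _)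
    have h3 := mul_le_mul_of_nonneg_left h2 hE
    rw [zero_pow two_ne_zero, add_zero] at h1
    linarith
  · have hl1 : 1 < lam k := (le_max_left _ _).trans_lt hk
    have hl0 : 0 < lam k := zero_lt_one.trans hl1
    have hlx : 1 / lam k < x₀ := by
      rw [one_div_lt hl0 hx₀]; exact (le_max_right _ _).trans_lt hk
    have hω1 : ω (1 / lam k) * lam k ≤ Λ * lam k ^ (2 * σ) := by
      have h1 : ω (1 / lam k) / (1 / lam k) ^ (1 - 2 * σ) ≤ Λ := hx ⟨by positivity, hlx⟩
      rw [div_le_iff₀ (by positivity)] at h1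
      have h2 : (1 / lam k) ^ (1 - 2 * σ) * lam k = lam k ^ (2 * σ) := by
        rw [one_div, Real.inv_rpow hl0.le, ← Real.rpow_neg hl0.le]
        nth_rewrite 2 [← Real.rpow_one (lam k)]
        rw [← Real.rpow_add hl0]
        ring_nf
      calc _ ≤ Λ * (1 / lam k) ^ (1 - 2 * σ) * lam k := by gcongr
        _ = _ := by rw [mul_assoc, h2]
    have hLl : lam k ^ (2 * σ) ≤ lam k := by
      calc _ ≤ lam k ^ (1:ℝ) := Real.rpow_le_rpow_of_exponent_le hl1.le (by linarith)
        _ = _ := Real.rpow_one _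
    have h1 := energy_le_of_subcritical (c := fun s => c (p s)) hδ hl0 hL hLl hμ₁ hpc
      (fun s => hc _ (hpmem s))
      (fun a b hab => (hpω a b).trans (hω.2.2.2.1 _ _ (abs_nonneg _) hab)) hω1 hlt.le hu
      (fun s hs => by simpa only [hpeq s hs] using hv s hs) ht
    exact h1.trans (mul_le_mul_of_nonneg_right (le_max_right _ _) hE)

/-- Pointwise convergence of functions sharing a modulus of continuity is uniform on `[0,T]`. -/
theorem tendstoUniformlyOn_of_modulus {T : ℝ} {ω : ℝ → ℝ} (hω : IsModulus ω)
    {c : ℕ → ℝ → ℝ} {cinf : ℝ → ℝ}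
    (hωc : ∀ n, ∀ a ∈ Icc (0:ℝ) T, ∀ b ∈ Icc (0:ℝ) T, |c n a - c n b| ≤ ω |a - b|)
    (hωinf : ∀ a ∈ Icc (0:ℝ) T, ∀ b ∈ Icc (0:ℝ) T, |cinf a - cinf b| ≤ ω |a - b|)
    (hconv : ∀ t ∈ Icc (0:ℝ) T, Tendsto (fun n => c n t) atTop (𝓝 (cinf t))) :
    TendstoUniformlyOn c cinf atTop (Icc 0 T) := by
  rw [Metric.tendstoUniformlyOn_iff]
  intro ε hε
  have h0 := (hω.1 0 self_mem_Ici).tendsto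
  rw [hω.2.1] at h0
  obtain ⟨η, hη, H⟩ := Metric.tendsto_nhdsWithin_nhds.1 h0 (ε / 3) (by positivity)
  obtain ⟨S, hS, hSfin, hcov⟩ := (isCompact_Icc (a := (0:ℝ)) (b := T)).finite_cover_balls hη
  have hev : ∀ᶠ n in atTop, ∀ s ∈ S, dist (c n s) (cinf s) < ε / 3 :=
    (eventually_all_finite hSfin).2 fun s hs =>
      Metric.tendsto_nhds.1 (hconv s (hS hs)) (ε / 3) (by positivity)
  filter_upwards [hev] with n hn t ht
  obtain ⟨s, hs, hst⟩ := mem_iUnion₂.1 (hcov ht)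
  have hω1 : ω |t - s| < ε / 3 := by
    have := H (x := |t - s|) (mem_Ici.2 (abs_nonneg _)) (by simpa [Real.dist_eq] using hst)
    exact (le_abs_self _).trans_lt (by simpa [Real.dist_eq] using this)
  have h1 := (hωinf t ht s (hS hs)).trans_lt hω1
  have h2 := (hωc n t ht s (hS hs)).trans_lt hω1
  have h3 := hn s hs
  rw [Real.dist_eq] at h3 ⊢
  rw [abs_lt] at *
  constructor <;> linarith [h1.1, h1.2, h2.1, h2.2, h3.1, h3.2]

/-- Convergence of solutions of linear problems in the subcritical case: if the
equicontinuous, strictly hyperbolic coefficients `c n` converge pointwise to `c∞`,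
then the solutions converge uniformly in the energy space.  The spectral condition
`4δ²μ₁ > Λ∞² + 2δΛ∞` (with `Λ∞ = limsup_{ε→0⁺} ω(ε)/ε^{1-2σ}`) is encoded by the
existence of an eventual upper bound `Λ` satisfying the strict inequality. -/
theorem convergence_subcritical
    (T : ℝ) (hT : 0 < T) (lam : ℕ → ℝ) (hlam : ∀ k, 0 ≤ lam k)
    (μ₁ μ₂ : ℝ) (hμ₁ : 0 < μ₁) (hμ : μ₁ ≤ μ₂)
    (ω : ℝ → ℝ) (hω : IsModulus ω)
    (c : ℕ → ℝ → ℝ) (cinf : ℝ → ℝ)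
    (hbd : ∀ n, ∀ t ∈ Icc (0:ℝ) T, μ₁ ≤ c n t ∧ c n t ≤ μ₂)
    (hωc : ∀ n, ∀ a ∈ Icc (0:ℝ) T, ∀ b ∈ Icc (0:ℝ) T, |c n a - c n b| ≤ ω |a - b|)
    (hconv : ∀ t ∈ Icc (0:ℝ) T, Tendsto (fun n => c n t) atTop (𝓝 (cinf t)))
    (σ δ : ℝ) (hσ0 : 0 ≤ σ) (hσ : σ ≤ 1 / 2) (hδ : 0 < δ)
    (hΛ : ∃ Λ : ℝ, 0 ≤ Λ ∧ (∀ᶠ x in 𝓝[>] (0:ℝ), ω x / x ^ (1 - 2 * σ) ≤ Λ) ∧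
      Λ ^ 2 + 2 * δ * Λ < 4 * δ ^ 2 * μ₁)
    (u0 u1 : ℕ → ℝ)
    (hu0 : Summable fun k => u0 k ^ 2)
    (hu0' : Summable fun k => lam k ^ 2 * u0 k ^ 2)
    (hu1 : Summable fun k => u1 k ^ 2)
    (u v : ℕ → ℕ → ℝ → ℝ) (uinf vinf : ℕ → ℝ → ℝ)
    (hsol : ∀ n, IsLinearSol lam (c n) σ δ T u0 u1 (u n) (v n))
    (hsolinf : IsLinearSol lam cinf σ δ T u0 u1 uinf vinf) :
    ∀ ε : ℝ, 0 < ε → ∃ N : ℕ, ∀ n ≥ N, ∀ t ∈ Icc (0:ℝ) T,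
      (∑' k, (vinf k t - v n k t) ^ 2) +
        (∑' k, lam k ^ 2 * (uinf k t - u n k t) ^ 2) < ε := by
  have hbdinf : ∀ t ∈ Icc (0:ℝ) T, μ₁ ≤ cinf t ∧ cinf t ≤ μ₂ := fun t ht =>
    ⟨ge_of_tendsto' (hconv t ht) fun n => (hbd n t ht).1,
      le_of_tendsto' (hconv t ht) fun n => (hbd n t ht).2⟩
  have hωinf : ∀ a ∈ Icc (0:ℝ) T, ∀ b ∈ Icc (0:ℝ) T, |cinf a - cinf b| ≤ ω |a - b| :=
    fun a ha b hb => le_of_tendsto' ((hconv a ha).sub (hconv b hb)).abs fun n => hωc n a ha b hb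
  have hunif := tendstoUniformlyOn_of_modulus hω hωc hωinf hconv
  have hcinf : ContinuousOn cinf (Icc 0 T) := continuousOn_of_modulus hω hωinf
  have hcn : ∀ n, ContinuousOn (c n) (Icc 0 T) := fun n => continuousOn_of_modulus hω (hωc n)
  obtain ⟨C, hC⟩ := exists_uniform_energy_bound hT hlam hμ₁ hμ hω hσ hδ hΛ u0 u1
  have hEinf := hC cinf hbdinf hωinf uinf vinf hsolinf
  have hEn := fun n => hC (c n) (hbd n) (hωc n) (u n) (v n) (hsol n)
  have hμ₂ : 0 < μ₂ := hμ₁.trans_le hμ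
  have hbound : ∀ n k, ∀ t ∈ Icc (0:ℝ) T,
      (vinf k t - v n k t) ^ 2 + lam k ^ 2 * (uinf k t - u n k t) ^ 2 ≤
        4 * C * (u1 k ^ 2 + lam k ^ 2 * u0 k ^ 2) := by
    intro n k t ht
    have h1 := hEinf k t ht
    have h2 := hEn n k t ht
    nlinarith [sq_nonneg (vinf k t + v n k t), sq_nonneg (lam k * (uinf k t + u n k t))]
  have hsum : Summable fun k => 4 * C * (u1 k ^ 2 + lam k ^ 2 * u0 k ^ 2) :=
    (hu1.add hu0').mul_left _
  have hcomp : ∀ k, Tendsto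
      (fun q : ℕ × ℝ => (vinf k q.2 - v q.1 k q.2) ^ 2
        + lam k ^ 2 * (uinf k q.2 - u q.1 k q.2) ^ 2)
      (atTop ×ˢ 𝓟 (Icc 0 T)) (𝓝 0) := by
    intro k
    obtain ⟨U, hU⟩ := isCompact_Icc.exists_bound_of_continuousOn (s := Icc (0:ℝ) T)
      (f := uinf k) fun t ht => (hsolinf.2.2.1 k t ht).continuousWithinAt
    have hU0 : 0 ≤ U := (norm_nonneg _).trans (hU 0 ⟨le_rfl, hT.le⟩)
    set M := Real.exp ((lam k * (1 + μ₂) + 1) * T)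
    have hlim : Tendsto (fun r : ℝ => (r * (lam k ^ 2 * U)) ^ 2 * M) (𝓝[>] 0) (𝓝 0) := by
      have : Continuous fun r : ℝ => (r * (lam k ^ 2 * U)) ^ 2 * M := by fun_prop
      simpa using (this.tendsto 0).mono_left nhdsWithin_le_nhds
    rw [Metric.tendsto_nhds]
    intro ε hε
    obtain ⟨r, hrε, hr⟩ := ((hlim.eventually (gt_mem_nhds hε)).and self_mem_nhdsWithin).exists
    rw [eventually_prod_principal_iff]
    filter_upwards [Metric.tendstoUniformlyOn_iff.1 hunif r hr] with n hn t ht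
    have h1 := energy_le_exp (T := T) (b := δ * lam k ^ (2 * σ)) (l := lam k) (μ := μ₂)
      (η := r * (lam k ^ 2 * U)) (c := c n)
      (f := fun s => -((cinf s - c n s) * (lam k ^ 2 * uinf k s)))
      (u := fun s => uinf k s - u n k s) (v := fun s => vinf k s - v n k s)
      (mul_nonneg hδ.le (Real.rpow_nonneg (hlam k) _)) (hlam k) hμ₂.le
      (fun s hs => (hsolinf.2.2.1 k s hs).sub ((hsol n).2.2.1 k s hs))
      (fun s hs => ((hsolinf.hasDerivWithinAt_velocity hcinf k hs).sub
        ((hsol n).hasDerivWithinAt_velocity (hcn n) k hs)).congr_deriv (by ring))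
      (fun s hs => abs_le.2 ⟨by linarith [(hbd n s hs).1], (hbd n s hs).2⟩)
      (fun s hs => by
        rw [abs_neg, abs_mul, abs_mul, abs_of_nonneg (sq_nonneg (lam k))]
        have := (hn s hs).le
        rw [Real.dist_eq] at this
        have := hU s hs
        rw [Real.norm_eq_abs] at this
        have := hr.le
        gcongr) ht
    simp only [hsolinf.1 k, hsolinf.2.1 k, (hsol n).1 k, (hsol n).2.1 k, sub_self,
      zero_pow two_ne_zero, mul_zero, add_zero, zero_add] at h1
    rw [Real.dist_eq, sub_zero, abs_of_nonneg (by positivity)]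
    exact h1.trans_lt hrε
  have hmain := tendsto_tsum_of_dominated_convergence hsum hcomp
    (by
      rw [eventually_prod_principal_iff]
      refine Eventually.of_forall fun n t ht k => ?_
      rw [Real.norm_eq_abs, abs_of_nonneg (by positivity)]
      exact hbound n k t ht)
  rw [tsum_zero] at hmain
  intro ε hε
  have hev := hmain.eventually (gt_mem_nhds hε)
  rw [eventually_prod_principal_iff] at hev
  obtain ⟨N, hN⟩ := eventually_atTop.1 hev
  refine ⟨N, fun n hn t ht => ?_⟩
  have hs1 : Summable fun k => (vinf k t - v n k t) ^ 2 :=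
    hsum.of_nonneg_of_le (fun k => sq_nonneg _) fun k =>
      (le_add_of_nonneg_right (by positivity)).trans (hbound n k t ht)
  have hs2 : Summable fun k => lam k ^ 2 * (uinf k t - u n k t) ^ 2 :=
    hsum.of_nonneg_of_le (fun k => by positivity) fun k =>
      (le_add_of_nonneg_left (sq_nonneg _)).trans (hbound n k t ht)
  rw [← hs1.tsum_add hs2]
  exact hN n hn t ht
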